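/- Let A = (Q, Σ, δ) be a strongly connected partial DFA with non-empty state set and let r be the minimal non-zero rank over all words in A. Then for every non-empty subset S ⊆ Q, there exists a word w ∈ Σ* such that 1 ≤ |δ(S,w)| ≤ r. -/

import Mathlib

open scoped Classical

section Defs

variable {Q A : Type*}

/-- Action of a word in a partial DFA with transition function `δ`
(`none` means the undefined value ⊥). -/
def stepWord (δ : Q → A → Option Q) : Q → List A → Option Q
  | q, [] => some q
  | q, a :: w => (δ q a).bind (fun p => stepWord δ p w)

/-- The image `δ(S, w)` of a set of states under the action of a word. -/
def img (δ : Q → A → Option Q) (S : Set Q) (w : List A) : Set Q :=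
  {p | ∃ q ∈ S, stepWord δ q w = some p}

/-- The inseparability equivalence `p ≡ q`. -/
def Insep (δ : Q → A → Option Q) (p q : Q) : Prop :=
  ∀ u : List A, (stepWord δ p u).isSome ↔ (stepWord δ q u).isSome

/-- `κ(S)`: the number of inseparability classes intersecting `S`. -/
noncomputable def kappa (δ : Q → A → Option Q) (S : Set Q) : ℕ :=
  {C : Set Q | ∃ p ∈ S, C = {q | Insep δ p q}}.ncard

def StronglyConnected (δ : Q → A → Option Q) : Prop :=
  ∀ p q : Q, ∃ w : List A, stepWord δ p w = some q

/-- The transition function of the fixing automaton `A^F`. -/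
def fixDelta (δ : Q → A → Option Q) (q : Q) (a : A) : Q := (δ q a).getD q

/-- Action of a word in a complete DFA. -/
def stepWordC (δc : Q → A → Q) (q : Q) (w : List A) : Q := w.foldl δc q

/-- The image of a set of states under the action of a word in a complete DFA. -/
def imgC (δc : Q → A → Q) (S : Set Q) (w : List A) : Set Q :=
  (fun q => stepWordC δc q w) '' S

end Defs

theorem stepWord_append {Q A : Type*} (δ : Q → A → Option Q) (q : Q) (u v : List A) :
    stepWord δ q (u ++ v) = (stepWord δ q u).bind (fun p => stepWord δ p v) := by
  induction u generalizing q with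
  | nil => rfl
  | cons a u ih =>
    simp only [List.cons_append, stepWord]
    cases δ q a with
    | none => rfl
    | some p => exact ih p

theorem img_append_subset {Q A : Type*} (δ : Q → A → Option Q) (S : Set Q) (u v : List A) :
    img δ S (u ++ v) ⊆ img δ Set.univ v := by
  rintro p ⟨q, -, h⟩
  rw [stepWord_append, Option.bind_eq_some_iff] at h
  obtain ⟨x, -, hx⟩ := h
  exact ⟨x, Set.mem_univ x, hx⟩

/-- In a strongly connected partial DFA with minimal non-zero rank `r`,
every non-empty subset `S` can be mapped by some word to a non-empty set of size at most `r`. -/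
theorem stmt5 {Q A : Type*} [Fintype Q] [Nonempty Q] (δ : Q → A → Option Q)
    (hsc : StronglyConnected δ) (r : ℕ)
    (hr : r = sInf {k : ℕ | ∃ w : List A, (img δ Set.univ w).ncard = k ∧ k ≠ 0})
    (S : Set Q) (hS : S.Nonempty) :
    ∃ w : List A, 1 ≤ (img δ S w).ncard ∧ (img δ S w).ncard ≤ r := by
  have hne : {k : ℕ | ∃ w : List A, (img δ Set.univ w).ncard = k ∧ k ≠ 0}.Nonempty := by
    obtain ⟨q⟩ := ‹Nonempty Q›
    exact ⟨_, [], rfl, Set.ncard_ne_zero_of_mem (a := q) ⟨q, Set.mem_univ q, rfl⟩⟩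
  obtain ⟨v, hv, hv0⟩ := Nat.sInf_mem hne
  rw [← hr] at hv hv0
  obtain ⟨p, q, -, hqp⟩ := Set.nonempty_of_ncard_ne_zero (hv ▸ hv0)
  obtain ⟨s, hs⟩ := hS
  obtain ⟨u, hu⟩ := hsc s q
  refine ⟨u ++ v, ?_, ?_⟩
  · refine Nat.one_le_iff_ne_zero.mpr (Set.ncard_ne_zero_of_mem (a := p) ⟨s, hs, ?_⟩)
    rw [stepWord_append, hu, Option.bind_some, hqp]
  · exact hv ▸ Set.ncard_le_ncard (img_append_subset δ S u v)
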